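/- arXiv:2512.21444 — 2 statements merged into one kernel-verified Lean document; each statement's English description precedes it below -/
import Mathlib

section
/- The dual lattice ℒ* of ℒ = σ((1−ζ)ℤ[ζ]) satisfies ℒ* ⊆ (1/25)ℒ. -/
open Complex MeasureTheory Real

noncomputable section

/-- ζ = exp(2πi/5), a primitive fifth root of unity. -/
def ζ₅ : ℂ := Complex.exp (2 * Real.pi * Complex.I / 5)

/-- Integer combination a + b z + c z² + d z³. -/
def comb (a b c d : ℤ) (z : ℂ) : ℂ := a + b * z + c * z ^ 2 + d * z ^ 3

/-- The lattice ℒ = σ((1−ζ)ℤ[ζ]) ⊆ ℂ × ℂ ≅ ℝ⁴, where σ = (σ₁, σ₂) is the Minkowski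
embedding, σ₁(ζ) = ζ and σ₂(ζ) = ζ². -/
def PenLat : Set (ℂ × ℂ) :=
  { p | ∃ a b c d : ℤ,
      p = ((1 - ζ₅) * comb a b c d ζ₅, (1 - ζ₅ ^ 2) * comb a b c d (ζ₅ ^ 2)) }

/-- The standard real inner product on ℂ ≅ ℝ². -/
def rdot (z w : ℂ) : ℝ := z.re * w.re + z.im * w.im

/-- The dual lattice ℒ* with respect to the standard inner product on ℝ⁴ = ℂ × ℂ. -/
def dualLat : Set (ℂ × ℂ) :=
  { ξ | ∀ ℓ ∈ PenLat, ∃ k : ℤ, rdot ξ.1 ℓ.1 + rdot ξ.2 ℓ.2 = (k : ℝ) }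

/-- τ = (1+√5)/2, the golden ratio. -/
def τ₀ : ℝ := (1 + Real.sqrt 5) / 2

/-- P, the convex hull of the fifth roots of unity. -/
def Pent : Set ℂ := convexHull ℝ {1, ζ₅, ζ₅ ^ 2, ζ₅ ^ 3, ζ₅ ^ 4}

/-- The windows W_{m,ω} for m = 1, 2, 3, 4. -/
def Window (m : ℕ) (ω : ℂ) : Set ℂ :=
  match m with
  | 1 => (fun z => z - 1 + ω) '' Pent
  | 2 => (fun z => -(τ₀ : ℂ) * z - 2 + ω) '' Pent
  | 3 => (fun z => (τ₀ : ℂ) * z - 3 + ω) '' Pent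
  | 4 => (fun z => -z - 4 + ω) '' Pent
  | _ => ∅

/-- The Fourier transform of the indicator function of a set A ⊆ ℂ ≅ ℝ². -/
def ftInd (A : Set ℂ) (y : ℂ) : ℂ :=
  ∫ x in A, Complex.exp (-(2 * Real.pi * Complex.I) * (rdot x y))

/-- The fifth cyclotomic relation for `ζ₅`. -/
lemma zeta₅_cyclotomic : 1 + ζ₅ + ζ₅ ^ 2 + ζ₅ ^ 3 + ζ₅ ^ 4 = 0 := by
  have h : IsPrimitiveRoot ζ₅ 5 := by
    simpa [ζ₅] using Complex.isPrimitiveRoot_exp 5 (by norm_num)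
  simpa [Finset.sum_range_succ] using h.geom_sum_eq_zero (by norm_num)

lemma zeta₅_pow_five : ζ₅ ^ 5 = 1 := by linear_combination (ζ₅ - 1) * zeta₅_cyclotomic

lemma conj_zeta₅ : (starRingEnd ℂ) ζ₅ = ζ₅ ^ 4 := by
  have h0 : ζ₅ ≠ 0 := Complex.exp_ne_zero _
  have hn : ‖ζ₅‖ = 1 := Complex.norm_eq_one_of_pow_eq_one zeta₅_pow_five (by norm_num)
  rw [← Complex.inv_eq_conj hn]
  field_simp
  linear_combination -zeta₅_pow_five

lemma two_mul_rdot (z w : ℂ) :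
    (2 * rdot z w : ℂ) = z * (starRingEnd ℂ) w + (starRingEnd ℂ) z * w := by
  apply Complex.ext <;> simp [rdot] <;> ring

/-- Fourier inversion on `ℤ/5`: four samples of a combination of the nontrivial characters
determine the coefficient of the character `j ↦ z⁻ʲ`. -/
lemma fourier_coeff_of_cyclotomic {z X X' Y Y' s₀ s₁ s₂ s₃ : ℂ}
    (hz : 1 + z + z ^ 2 + z ^ 3 + z ^ 4 = 0)
    (h₀ : s₀ = X + X' + Y + Y')
    (h₁ : s₁ = X * z ^ 4 + X' * z + Y * z ^ 3 + Y' * z ^ 2)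
    (h₂ : s₂ = X * z ^ 3 + X' * z ^ 2 + Y * z + Y' * z ^ 4)
    (h₃ : s₃ = X * z ^ 2 + X' * z ^ 3 + Y * z ^ 4 + Y' * z) :
    5 * X = s₀ * (1 - z ^ 4) + s₁ * (z - z ^ 4) + s₂ * (z ^ 2 - z ^ 4) + s₃ * (z ^ 3 - z ^ 4) := by
  subst h₀ h₁ h₂ h₃
  grind

/-- Dividing an algebraic integer by `(1 - z⁴)` after scaling by `5` lands in `(1 - z)ℤ[z]`. -/
lemma scaled_eq_one_sub_mul_comb {z x : ℂ} {k₀ k₁ k₂ k₃ : ℤ}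
    (hz : 1 + z + z ^ 2 + z ^ 3 + z ^ 4 = 0)
    (h : 5 * (x * (1 - z ^ 4)) = 2 * k₀ * (1 - z ^ 4) + 2 * k₁ * (z - z ^ 4)
      + 2 * k₂ * (z ^ 2 - z ^ 4) + 2 * k₃ * (z ^ 3 - z ^ 4)) :
    25 * x = (1 - z) * comb (8 * k₀ + 6 * k₁ + 4 * k₂ + 2 * k₃)
      (6 * k₀ + 12 * k₁ + 8 * k₂ + 4 * k₃)
      (4 * k₀ + 8 * k₁ + 12 * k₂ + 6 * k₃)
      (2 * k₀ + 4 * k₁ + 6 * k₂ + 8 * k₃) z := by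
  have norm_eq : (1 - z) * (1 - z ^ 2) * (1 - z ^ 3) * (1 - z ^ 4) = 5 := by
    clear h
    grind
  have hx : 25 * x = (1 - z) * (1 - z ^ 2) * (1 - z ^ 3) * (5 * (x * (1 - z ^ 4))) := by
    linear_combination -5 * x * norm_eq
  rw [hx, h]
  clear h hx norm_eq
  simp only [comb]
  push_cast
  grind

/-- **Lemma.** The dual lattice ℒ* of ℒ = σ((1−ζ)ℤ[ζ]) satisfies ℒ* ⊆ (1/25)ℒ,
i.e. 25·ξ ∈ ℒ for every ξ ∈ ℒ*. -/
theorem dualLat_subset_inv25_lat :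
    ∀ ξ : ℂ × ℂ, ξ ∈ dualLat → ((25 : ℂ) * ξ.1, (25 : ℂ) * ξ.2) ∈ PenLat := by
  rintro ⟨x, y⟩ h
  have hz := zeta₅_cyclotomic
  have h5 := zeta₅_pow_five
  have hz2 : 1 + ζ₅ ^ 2 + (ζ₅ ^ 2) ^ 2 + (ζ₅ ^ 2) ^ 3 + (ζ₅ ^ 2) ^ 4 = 0 := by grind
  have key (a b c d : ℤ) : ∃ k : ℤ, (2 * k : ℂ) =
      x * (1 - ζ₅ ^ 4) * comb a b c d (ζ₅ ^ 4)
      + (starRingEnd ℂ) x * (1 - ζ₅) * comb a b c d ζ₅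
      + y * (1 - ζ₅ ^ 8) * comb a b c d (ζ₅ ^ 8)
      + (starRingEnd ℂ) y * (1 - ζ₅ ^ 2) * comb a b c d (ζ₅ ^ 2) := by
    obtain ⟨k, hk⟩ := h _ ⟨a, b, c, d, rfl⟩
    refine ⟨k, ?_⟩
    have hk' := congrArg (fun r : ℝ => (2 * r : ℂ)) hk
    simp only [Complex.ofReal_add, mul_add, two_mul_rdot, Complex.ofReal_intCast] at hk'
    rw [← hk']
    simp only [comb, map_mul, map_sub, map_add, map_pow, map_one, map_intCast, conj_zeta₅]
    ring
  obtain ⟨k₀, h₀⟩ := key 1 0 0 0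
  obtain ⟨k₁, h₁⟩ := key 0 1 0 0
  obtain ⟨k₂, h₂⟩ := key 0 0 1 0
  obtain ⟨k₃, h₃⟩ := key 0 0 0 1
  simp only [comb, Int.cast_zero, Int.cast_one] at h₀ h₁ h₂ h₃
  have hX := fourier_coeff_of_cyclotomic (z := ζ₅) (s₀ := 2 * k₀) (s₁ := 2 * k₁) (s₂ := 2 * k₂)
    (s₃ := 2 * k₃) (X := x * (1 - ζ₅ ^ 4)) (X' := (starRingEnd ℂ) x * (1 - ζ₅))
    (Y := y * (1 - ζ₅ ^ 8)) (Y' := (starRingEnd ℂ) y * (1 - ζ₅ ^ 2)) hz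
    (by linear_combination h₀)
    (by linear_combination h₁ + y * (1 - ζ₅ ^ 8) * ζ₅ ^ 3 * h5)
    (by linear_combination h₂ + (x * (1 - ζ₅ ^ 4) * ζ₅ ^ 3
      + y * (1 - ζ₅ ^ 8) * ζ₅ * (ζ₅ ^ 10 + ζ₅ ^ 5 + 1)) * h5)
    (by linear_combination h₃ + (x * (1 - ζ₅ ^ 4) * ζ₅ ^ 2 * (ζ₅ ^ 5 + 1)
      + y * (1 - ζ₅ ^ 8) * ζ₅ ^ 4 * (ζ₅ ^ 15 + ζ₅ ^ 10 + ζ₅ ^ 5 + 1)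
      + (starRingEnd ℂ) y * (1 - ζ₅ ^ 2) * ζ₅) * h5)
  have hY := fourier_coeff_of_cyclotomic (z := ζ₅ ^ 2) (s₀ := 2 * k₀) (s₁ := 2 * k₁)
    (s₂ := 2 * k₂) (s₃ := 2 * k₃) (X := y * (1 - (ζ₅ ^ 2) ^ 4))
    (X' := (starRingEnd ℂ) y * (1 - ζ₅ ^ 2))
    (Y := (starRingEnd ℂ) x * (1 - ζ₅)) (Y' := x * (1 - ζ₅ ^ 4)) hz2
    (by linear_combination h₀)
    (by linear_combination h₁ - (starRingEnd ℂ) x * (1 - ζ₅) * ζ₅ * h5)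
    (by linear_combination h₂ + y * (1 - ζ₅ ^ 8) * ζ₅ ^ 6 * (ζ₅ ^ 5 + 1) * h5)
    (by linear_combination h₃ + (y * (1 - ζ₅ ^ 8) * ζ₅ ^ 4 * (ζ₅ ^ 15 + ζ₅ ^ 10 + ζ₅ ^ 5 + 1)
      - (starRingEnd ℂ) x * (1 - ζ₅) * ζ₅ ^ 3
      + x * (1 - ζ₅ ^ 4) * ζ₅ ^ 2 * (ζ₅ ^ 5 + 1)) * h5)
  exact ⟨_, _, _, _, Prod.ext (scaled_eq_one_sub_mul_comb hz hX)
    (scaled_eq_one_sub_mul_comb hz2 hY)⟩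

end
end

section
/- The set {σ₂(α) : α ∈ (1−ζ)ℤ[ζ]} = (1−ζ²)ℤ[ζ] is dense in ℂ. -/
open Complex MeasureTheory Real

noncomputable section

/-- The fifth root of unity `ζ₅ ^ 2` is primitive. -/
theorem isPrimitiveRoot_zeta_sq : IsPrimitiveRoot (ζ₅ ^ 2) 5 := by
  have h : IsPrimitiveRoot ζ₅ 5 := by
    simpa [ζ₅] using Complex.isPrimitiveRoot_exp 5 (by norm_num)
  exact h.pow_of_coprime 2 (by norm_num)

theorem conj_eq_pow_four {w : ℂ} (hw : w ^ 5 = 1) : (starRingEnd ℂ) w = w ^ 4 := by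
  have hn : ‖w‖ = 1 := Complex.norm_eq_one_of_pow_eq_one hw (by norm_num)
  rw [← Complex.inv_eq_conj hn]
  exact inv_eq_of_mul_eq_one_right (by rw [← hw]; ring)

theorem geom_sum_eq_zero_of_isPrimitiveRoot_five {w : ℂ} (hw : IsPrimitiveRoot w 5) :
    1 + w + w ^ 2 + w ^ 3 + w ^ 4 = 0 := by
  simpa [Finset.sum_range_succ] using hw.geom_sum_eq_zero (by norm_num)

theorem im_ne_zero_of_isPrimitiveRoot_five {w : ℂ} (hw : IsPrimitiveRoot w 5) : w.im ≠ 0 := by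
  intro h
  have h4 : w = w ^ 4 := by
    rw [← conj_eq_pow_four hw.pow_eq_one]
    exact (Complex.conj_eq_iff_im.mpr h).symm
  have h2 : w ^ 2 = 1 := by
    calc w ^ 2 = w * w := sq w
      _ = w * w ^ 4 := by rw [← h4]
      _ = w ^ 5 := by ring
      _ = 1 := hw.pow_eq_one
  exact hw.pow_ne_one_of_pos_of_lt (by norm_num) (by norm_num) h2

/-- The trace `w + w⁻¹` of a fifth root of unity to the maximal real subfield. -/
theorem two_mul_re_eq {w : ℂ} (hw : IsPrimitiveRoot w 5) :
    ((2 * w.re : ℝ) : ℂ) = -1 - w ^ 2 - w ^ 3 := by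
  rw [← Complex.add_conj, conj_eq_pow_four hw.pow_eq_one]
  linear_combination geom_sum_eq_zero_of_isPrimitiveRoot_five hw

theorem irrational_two_mul_re {w : ℂ} (hw : IsPrimitiveRoot w 5) : Irrational (2 * w.re) := by
  have hsq : (2 * w.re) ^ 2 + 2 * w.re - 1 = 0 := by
    have h : (((2 * w.re) ^ 2 + 2 * w.re - 1 : ℝ) : ℂ) = 0 := by
      have ht := two_mul_re_eq hw
      push_cast at ht ⊢
      rw [ht]
      linear_combination (w ^ 2 + w - 1) * geom_sum_eq_zero_of_isPrimitiveRoot_five hw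
    exact_mod_cast h
  have hprod : (2 * w.re + goldenRatio) * (2 * w.re + goldenConj) = 0 := by
    linear_combination hsq + 2 * w.re * Real.goldenRatio_add_goldenConj +
      Real.goldenRatio_mul_goldenConj
  rcases mul_eq_zero.mp hprod with h | h
  · rw [eq_neg_of_add_eq_zero_left h]
    exact Real.goldenRatio_irrational.neg
  · rw [eq_neg_of_add_eq_zero_left h]
    exact Real.goldenConj_irrational.neg

theorem denseRange_int_add_int_mul {t : ℝ} (ht : Irrational t) :
    DenseRange fun p : ℤ × ℤ => (p.1 + p.2 * t : ℝ) := by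
  have h := dense_addSubgroupClosure_pair_iff (a := t) (b := 1) |>.mpr (by rwa [div_one])
  refine h.mono fun x hx => ?_
  obtain ⟨m, n, rfl⟩ := AddSubgroup.mem_closure_pair.mp hx
  exact ⟨(n, m), by simp [add_comm]⟩

theorem surjective_mul_add_mul {u w : ℂ} (hu : u ≠ 0) (hw : w.im ≠ 0) :
    Function.Surjective fun p : ℝ × ℝ => u * (p.1 + p.2 * w) := by
  intro z
  refine ⟨((z / u).re - (z / u).im / w.im * w.re, (z / u).im / w.im), ?_⟩
  have h : (((z / u).re - (z / u).im / w.im * w.re : ℝ) : ℂ) +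
      (((z / u).im / w.im : ℝ) : ℂ) * w = z / u := by
    apply Complex.ext
    · simp only [Complex.add_re, Complex.ofReal_re, Complex.re_ofReal_mul]
      ring
    · simp only [Complex.add_im, Complex.ofReal_im, Complex.im_ofReal_mul]
      field_simp
      ring
  simp only [h]
  exact mul_div_cancel₀ z hu

/-- **Lemma.** The image of the ideal (1−ζ)ℤ[ζ] under the embedding σ₂ (determined by
σ₂(ζ) = ζ²), namely (1−ζ²)ℤ[ζ²] = (1−ζ²)ℤ[ζ], is dense in ℂ. -/
theorem star_image_dense :
    Dense {z : ℂ | ∃ a b c d : ℤ, z = (1 - ζ₅ ^ 2) * comb a b c d (ζ₅ ^ 2)} := by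
  have hw := isPrimitiveRoot_zeta_sq
  have ht := two_mul_re_eq hw
  generalize ζ₅ ^ 2 = w at hw ht ⊢
  have hu : 1 - w ≠ 0 := sub_ne_zero.mpr (hw.ne_one (by norm_num)).symm
  have hd := denseRange_int_add_int_mul (irrational_two_mul_re hw)
  have hdense := (surjective_mul_add_mul hu (im_ne_zero_of_isPrimitiveRoot_five hw)).denseRange.comp
    (hd.prodMap hd) (by fun_prop)
  refine hdense.mono ?_
  rintro _ ⟨⟨⟨m, n⟩, ⟨p, q⟩⟩, rfl⟩
  refine ⟨m - n + q, p, q - n, -n, ?_⟩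
  simp only [Function.comp_apply, Prod.map_apply, Complex.ofReal_add, Complex.ofReal_mul _ (2 * w.re),
    ht, comb]
  push_cast
  linear_combination (1 - w) * (-q) * geom_sum_eq_zero_of_isPrimitiveRoot_five hw

end
end
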